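/- In ℝ^n with n ≥ 2 and 0 < s < 1, the function u(x) = ((n−2s) constant normalization) c · (1+|x|²)^{−(n−2s)/2}, with c = ( Γ(n/2+s)/Γ(n/2−s) · 2^{2s} )^{(n−2s)/(4s)}, is a positive solution of the nonlocal Yamabe equation (−Δ)^s u = u^{(n+2s)/(n−2s)}. -/

import Mathlib

open Real MeasureTheory Set

/-- The Euclidean heat semigroup `P_t u (x)`. -/
noncomputable def heatSemigroup (n : ℕ) (t : ℝ) (u : EuclideanSpace ℝ (Fin n) → ℝ)
    (x : EuclideanSpace ℝ (Fin n)) : ℝ :=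
  ∫ x' : EuclideanSpace ℝ (Fin n),
    (4 * π * t) ^ (-(n:ℝ)/2) * Real.exp (-‖x - x'‖^2 / (4*t)) * u x'

/-- The fractional Laplacian `(-Δ)^s` defined via Balakrishnan's formula. -/
noncomputable def fracLap (n : ℕ) (s : ℝ) (u : EuclideanSpace ℝ (Fin n) → ℝ)
    (x : EuclideanSpace ℝ (Fin n)) : ℝ :=
  -(s / Real.Gamma (1 - s)) *
    ∫ t in Ioi (0:ℝ), t ^ (-1 - s) * (heatSemigroup n t u x - u x)

open Filter Topology

/-- Integration of an exponential against an inverse Gamma density. -/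
theorem integral_rpow_neg_mul_exp_neg_div {A β : ℝ} (hA : 0 < A) (hβ : 0 < β) :
    IntegrableOn (fun σ : ℝ => σ ^ (-β - 1) * Real.exp (-(A / σ))) (Ioi 0) ∧
    ∫ σ in Ioi (0:ℝ), σ ^ (-β - 1) * Real.exp (-(A / σ)) = (1 / A) ^ β * Real.Gamma β := by
  have key : EqOn (fun x : ℝ => (|(-1:ℝ)| * x ^ ((-1:ℝ) - 1)) •
        (fun y : ℝ => y ^ (β - 1) * Real.exp (-(A * y))) (x ^ (-1:ℝ)))
      (fun σ : ℝ => σ ^ (-β - 1) * Real.exp (-(A / σ))) (Ioi 0) := by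
    intro x hx
    have hx : 0 < x := hx
    simp only [abs_neg, abs_one, one_mul, smul_eq_mul]
    rw [← Real.rpow_mul hx.le, ← mul_assoc, ← Real.rpow_add hx, Real.rpow_neg_one, div_eq_mul_inv]
    congr 2
    ring
  have h := Real.integral_rpow_mul_exp_neg_mul_Ioi hβ hA
  constructor
  · rw [← integrableOn_congr_fun key measurableSet_Ioi,
      integrableOn_Ioi_comp_rpow_iff (fun y : ℝ => y ^ (β - 1) * Real.exp (-(A * y)))
        (by norm_num : (-1:ℝ) ≠ 0)]
    exact .of_integral_ne_zero (by
      rw [h]; have := Real.Gamma_pos_of_pos hβ; positivity)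
  · rw [← setIntegral_congr_fun measurableSet_Ioi key,
      integral_comp_rpow_Ioi (fun y : ℝ => y ^ (β - 1) * Real.exp (-(A * y)))
        (by norm_num : (-1:ℝ) ≠ 0), h]

/-- The subordination integral for the power `lam ^ s`. -/
theorem integral_rpow_mul_one_sub_exp {s lam : ℝ} (hs0 : 0 < s) (hs1 : s < 1) (hl : 0 < lam) :
    IntegrableOn (fun t : ℝ => t ^ (-1 - s) * (1 - Real.exp (-(t * lam)))) (Ioi 0) ∧
    ∫ t in Ioi (0:ℝ), t ^ (-1 - s) * (1 - Real.exp (-(t * lam)))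
      = lam ^ s * (Real.Gamma (1 - s) / s) := by
  have hlow (t : ℝ) (ht : 0 < t) : 0 ≤ 1 - Real.exp (-(t * lam)) := by
    rw [sub_nonneg, Real.exp_le_one_iff]; have := mul_pos ht hl; linarith
  have hup1 (t : ℝ) : 1 - Real.exp (-(t * lam)) ≤ 1 := by
    have := Real.exp_pos (-(t * lam)); linarith
  have hup2 (t : ℝ) : 1 - Real.exp (-(t * lam)) ≤ t * lam := by
    have := Real.add_one_le_exp (-(t * lam)); linarith
  have hmeas : Measurable (fun t : ℝ => t ^ (-1 - s) * (1 - Real.exp (-(t * lam)))) := by fun_prop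
  have h_int : IntegrableOn (fun t : ℝ => t ^ (-1 - s) * (1 - Real.exp (-(t * lam)))) (Ioi 0) := by
    rw [← Ioc_union_Ioi_eq_Ioi zero_le_one]
    refine IntegrableOn.union ?_ ?_
    · have h1 : IntegrableOn (fun t : ℝ => t ^ (-s) * lam) (Ioc 0 1) := by
        refine Integrable.mul_const ?_ lam
        rw [← IntegrableOn, ← intervalIntegrable_iff_integrableOn_Ioc_of_le zero_le_one]
        exact intervalIntegral.intervalIntegrable_rpow' (by linarith)
      refine Integrable.mono' h1 hmeas.aestronglyMeasurable ?_
      filter_upwards [ae_restrict_mem measurableSet_Ioc] with t ht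
      have ht0 : 0 < t := ht.1
      rw [Real.norm_of_nonneg (mul_nonneg (Real.rpow_nonneg ht0.le _) (hlow t ht0))]
      calc _ ≤ t ^ (-1 - s) * (t * lam) := by gcongr; exact hup2 t
        _ = t ^ (-s) * lam := by
          rw [← mul_assoc, ← Real.rpow_add_one ht0.ne']; congr 2; ring
    · refine Integrable.mono' (integrableOn_Ioi_rpow_of_lt (a := -1 - s) (by linarith) one_pos)
        hmeas.aestronglyMeasurable ?_
      filter_upwards [ae_restrict_mem measurableSet_Ioi] with t ht
      have ht0 : 0 < t := one_pos.trans ht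
      rw [Real.norm_of_nonneg (mul_nonneg (Real.rpow_nonneg ht0.le _) (hlow t ht0))]
      exact mul_le_of_le_one_right (Real.rpow_nonneg ht0.le _) (hup1 t)
  refine ⟨h_int, ?_⟩
  have hG := Real.integral_rpow_mul_exp_neg_mul_Ioi (a := 1 - s) (by linarith) hl
  have hGpos := Real.Gamma_pos_of_pos (s := 1 - s) (by linarith)
  have hGi : IntegrableOn (fun t : ℝ => t ^ (1 - s - 1) * Real.exp (-(lam * t))) (Ioi 0) :=
    .of_integral_ne_zero (by rw [hG]; positivity)
  have hprod : EqOn (fun t : ℝ => (-(lam / s)) * (t ^ (1 - s - 1) * Real.exp (-(lam * t))))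
      (fun t : ℝ => (Real.exp (-(t * lam)) * lam) * (-(t ^ (-s) / s))) (Ioi 0) := by
    intro t _
    simp only [show 1 - s - 1 = -s by ring, mul_comm t lam]
    ring
  have h := integral_Ioi_mul_deriv_eq_deriv_mul (a := 0)
    (u := fun t : ℝ => 1 - Real.exp (-(t * lam))) (u' := fun t => Real.exp (-(t * lam)) * lam)
    (v := fun t : ℝ => -(t ^ (-s) / s)) (v' := fun t => t ^ (-1 - s)) (a' := 0) (b' := 0)
    ?_ ?_ ?_ ?_ ?_ ?_
  · simp only [mul_comm (_ ^ (-1 - s))]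
    rw [h, ← setIntegral_congr_fun measurableSet_Ioi hprod, integral_const_mul, hG, one_div,
      Real.inv_rpow hl.le, Real.rpow_sub hl, Real.rpow_one]
    have := Real.rpow_pos_of_pos hl s
    field_simp
    ring
  · intro t _
    have := ((hasDerivAt_id t).mul_const lam).neg.exp.const_sub 1
    simpa using this
  · intro t ht
    have := ((Real.hasDerivAt_rpow_const (x := t) (p := -s) (Or.inl (ne_of_gt ht))).div_const s).neg
    refine this.congr_deriv ?_
    rw [show -s - 1 = -1 - s by ring]
    field_simp
  · simpa only [Pi.mul_def, mul_comm] using h_int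
  · exact (integrableOn_congr_fun hprod measurableSet_Ioi).1 (hGi.const_mul _)
  · have hlim : Tendsto (fun t : ℝ => t ^ (1 - s) * (lam / s)) (𝓝[>] 0) (𝓝 0) := by
      have : ContinuousAt (fun t : ℝ => t ^ (1 - s) * (lam / s)) 0 :=
        (Real.continuousAt_rpow_const _ _ (Or.inr (by linarith))).mul_const _
      have h0 := this.tendsto
      rw [Real.zero_rpow (by linarith), zero_mul] at h0
      exact h0.mono_left nhdsWithin_le_nhds
    refine squeeze_zero_norm' ?_ hlim
    filter_upwards [self_mem_nhdsWithin] with t ht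
    have ht0 : 0 < t := ht
    simp only [Pi.mul_apply, norm_mul, norm_neg, norm_div]
    rw [Real.norm_of_nonneg (hlow t ht0), Real.norm_of_nonneg (Real.rpow_nonneg ht0.le _),
      Real.norm_of_nonneg hs0.le]
    calc _ ≤ (t * lam) * (t ^ (-s) / s) := by gcongr; exact hup2 t
      _ = _ := by
        rw [show 1 - s = -s + 1 by ring, Real.rpow_add_one ht0.ne']; ring
  · have hlim : Tendsto (fun t : ℝ => t ^ (-s) / s) atTop (𝓝 0) := by
      simpa using (tendsto_rpow_neg_atTop hs0).div_const s
    refine squeeze_zero_norm' ?_ hlim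
    filter_upwards [eventually_gt_atTop 0] with t ht0
    simp only [Pi.mul_apply, norm_mul, norm_neg, norm_div]
    rw [Real.norm_of_nonneg (hlow t ht0), Real.norm_of_nonneg (Real.rpow_nonneg ht0.le _),
      Real.norm_of_nonneg hs0.le]
    exact mul_le_of_le_one_left (by positivity) (hup1 t)

/-- The Fourier transform of a Gaussian on Euclidean space, in real form. -/
theorem integral_exp_neg_mul_sq_norm_mul_cos {n : ℕ} {b : ℝ} (hb : 0 < b) (θ : ℝ)
    (w : EuclideanSpace ℝ (Fin n)) :
    ∫ v : EuclideanSpace ℝ (Fin n), Real.exp (-b * ‖v‖ ^ 2) * Real.cos (θ + inner ℝ w v)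
      = (π / b) ^ ((n:ℝ) / 2) * Real.exp (-‖w‖ ^ 2 / (4 * b)) * Real.cos θ := by
  have hb' : 0 < (b : ℂ).re := hb
  have hre (v : EuclideanSpace ℝ (Fin n)) :
      Real.exp (-b * ‖v‖ ^ 2) * Real.cos (θ + inner ℝ w v) =
        Complex.reCLM (Complex.exp (θ * Complex.I) *
          Complex.exp (-(b:ℂ) * ‖v‖ ^ 2 + Complex.I * (inner ℝ w v : ℝ))) := by
    rw [← Complex.exp_add, show θ * Complex.I + (-(b:ℂ) * ‖v‖ ^ 2 +
      Complex.I * (inner ℝ w v : ℝ)) = ((-b * ‖v‖ ^ 2 : ℝ) : ℂ) +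
        ((θ + inner ℝ w v : ℝ) : ℂ) * Complex.I by push_cast; ring, Complex.exp_add,
      ← Complex.ofReal_exp, Complex.reCLM_apply, Complex.re_ofReal_mul,
      Complex.exp_ofReal_mul_I_re]
  simp_rw [hre]
  rw [Complex.reCLM.integral_comp_comm
    ((GaussianFourier.integrable_cexp_neg_mul_sq_norm_add hb' Complex.I w).const_mul _),
    integral_const_mul, GaussianFourier.integral_cexp_neg_mul_sq_norm_add hb' Complex.I w,
    Complex.reCLM_apply]
  rw [show (π / b : ℂ) ^ ((Module.finrank ℝ (EuclideanSpace ℝ (Fin n)) : ℂ) / 2) *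
      Complex.exp (Complex.I ^ 2 * ‖w‖ ^ 2 / (4 * b)) =
      (((π / b) ^ ((n:ℝ) / 2) * Real.exp (-‖w‖ ^ 2 / (4 * b)) : ℝ) : ℂ) by
    rw [finrank_euclideanSpace_fin, Complex.I_sq]
    push_cast
    rw [Complex.ofReal_cpow (by positivity)]
    push_cast
    ring_nf, mul_comm, Complex.re_ofReal_mul, Complex.exp_ofReal_mul_I_re]

theorem integrable_exp_neg_mul_sq_norm {n : ℕ} {b : ℝ} (hb : 0 < b) :
    Integrable (fun v : EuclideanSpace ℝ (Fin n) => Real.exp (-b * ‖v‖ ^ 2)) :=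
  .of_integral_ne_zero (by
    rw [GaussianFourier.integral_rexp_neg_mul_sq_norm hb]; positivity)

/-- The heat semigroup acts on a cosine transform by multiplication. -/
theorem heatSemigroup_cosineTransform {n : ℕ} {m : EuclideanSpace ℝ (Fin n) → ℝ}
    (hm : Integrable m) {t : ℝ} (ht : 0 < t) (x : EuclideanSpace ℝ (Fin n)) :
    heatSemigroup n t (fun y => ∫ ξ, m ξ * Real.cos (inner ℝ y ξ)) x
      = ∫ ξ, Real.exp (-(t * ‖ξ‖ ^ 2)) * (m ξ * Real.cos (inner ℝ x ξ)) := by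
  have hb : 0 < 1 / (4 * t) := by positivity
  have hk : Integrable (fun x' : EuclideanSpace ℝ (Fin n) =>
      (4 * π * t) ^ (-(n:ℝ)/2) * Real.exp (-‖x - x'‖^2 / (4*t))) := by
    refine Integrable.const_mul ?_ _
    convert! (integrable_exp_neg_mul_sq_norm (n := n) hb).comp_sub_left x using 3
    ring
  have hprod : Integrable (Function.uncurry fun x' ξ : EuclideanSpace ℝ (Fin n) =>
      (4 * π * t) ^ (-(n:ℝ)/2) * Real.exp (-‖x - x'‖^2 / (4*t)) *
        (m ξ * Real.cos (inner ℝ x' ξ))) (volume.prod volume) := by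
    have h := hk.mul_prod hm
    refine (h.mul_bdd (c := 1) (g := fun p => Real.cos (inner ℝ p.1 p.2))
      (by fun_prop) (.of_forall fun p => Real.abs_cos_le_one _)).congr ?_
    exact .of_forall fun p => by simp only [Function.uncurry]; ring
  unfold heatSemigroup
  simp_rw [← integral_const_mul]
  rw [integral_integral_swap hprod]
  congr 1 with ξ
  have h1 := integral_exp_neg_mul_sq_norm_mul_cos hb (inner ℝ x ξ) (-ξ)
  rw [← integral_sub_left_eq_self _ volume x] at h1
  have h2 (x' : EuclideanSpace ℝ (Fin n)) :
      (4 * π * t) ^ (-(n:ℝ)/2) * Real.exp (-‖x - x'‖^2 / (4*t)) *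
        (m ξ * Real.cos (inner ℝ x' ξ)) = ((4 * π * t) ^ (-(n:ℝ)/2) * m ξ) *
      (Real.exp (-(1 / (4 * t)) * ‖x - x'‖ ^ 2) *
        Real.cos (inner ℝ x ξ + inner ℝ (-ξ) (x - x'))) := by
    rw [inner_neg_left, inner_sub_right, real_inner_comm x ξ, real_inner_comm x' ξ]
    ring_nf
  simp_rw [h2]
  rw [integral_const_mul, h1, norm_neg, neg_div, Real.rpow_neg (by positivity),
    show π / (1 / (4 * t)) = 4 * π * t by field_simp,
    show -‖ξ‖ ^ 2 / (4 * (1 / (4 * t))) = -(t * ‖ξ‖ ^ 2) by field_simp]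
  have : 0 < (4 * π * t) ^ ((n:ℝ)/2) := by positivity
  field_simp

/-- The fractional Laplacian acts on a cosine transform by multiplication with its symbol. -/
theorem fracLap_cosineTransform {n : ℕ} (hn : n ≠ 0) {s : ℝ} (hs0 : 0 < s) (hs1 : s < 1)
    {m : EuclideanSpace ℝ (Fin n) → ℝ} (hm : Integrable m)
    (hms : Integrable fun ξ => (‖ξ‖ ^ 2) ^ s * m ξ) (x : EuclideanSpace ℝ (Fin n)) :
    fracLap n s (fun y => ∫ ξ, m ξ * Real.cos (inner ℝ y ξ)) x
      = ∫ ξ, (‖ξ‖ ^ 2) ^ s * m ξ * Real.cos (inner ℝ x ξ) := by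
  have : Nonempty (Fin n) := ⟨⟨0, Nat.pos_of_ne_zero hn⟩⟩
  have hGpos := Real.Gamma_pos_of_pos (s := 1 - s) (by linarith)
  have hmcos : Integrable fun ξ => m ξ * Real.cos (inner ℝ x ξ) :=
    hm.mul_bdd (c := 1) (by fun_prop) (.of_forall fun p => Real.abs_cos_le_one _)
  have hne : ∀ᵐ ξ : EuclideanSpace ℝ (Fin n), 0 < ‖ξ‖ ^ 2 := by
    filter_upwards [compl_mem_ae_iff.2 (measure_singleton (0 : EuclideanSpace ℝ (Fin n)))] with ξ hξ
    have : ξ ≠ 0 := hξ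
    positivity
  have h_int : Integrable (Function.uncurry fun (t : ℝ) (ξ : EuclideanSpace ℝ (Fin n)) =>
      t ^ (-1 - s) * (1 - Real.exp (-(t * ‖ξ‖ ^ 2))) * (m ξ * Real.cos (inner ℝ x ξ)))
      ((volume.restrict (Ioi 0)).prod volume) := by
    refine (integrable_prod_iff' ?_).2 ⟨?_, ?_⟩
    · exact AEStronglyMeasurable.mul (Measurable.aestronglyMeasurable (by fun_prop))
        hmcos.aestronglyMeasurable.comp_snd
    · filter_upwards [hne] with ξ hξ
      exact (integral_rpow_mul_one_sub_exp hs0 hs1 hξ).1.mul_const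
        (m ξ * Real.cos (inner ℝ x ξ))
    · have h := ((hms.mul_bdd (c := 1) (g := fun ξ => Real.cos (inner ℝ x ξ)) (by fun_prop)
        (.of_forall fun p => Real.abs_cos_le_one _)).norm.mul_const (Real.Gamma (1 - s) / s))
      refine h.congr ?_
      filter_upwards [hne] with ξ hξ
      have h3 : EqOn (fun t : ℝ => ‖Function.uncurry (fun (t : ℝ) ξ =>
          t ^ (-1 - s) * (1 - Real.exp (-(t * ‖ξ‖ ^ 2))) * (m ξ * Real.cos (inner ℝ x ξ))) (t, ξ)‖)
          (fun t => t ^ (-1 - s) * (1 - Real.exp (-(t * ‖ξ‖ ^ 2))) *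
            ‖m ξ * Real.cos (inner ℝ x ξ)‖) (Ioi 0) := by
        intro t ht
        have ht0 : 0 < t := ht
        simp only [Function.uncurry]
        rw [norm_mul, Real.norm_of_nonneg]
        refine mul_nonneg (Real.rpow_nonneg ht0.le _) ?_
        rw [sub_nonneg, Real.exp_le_one_iff]
        have := mul_pos ht0 hξ
        linarith
      rw [setIntegral_congr_fun measurableSet_Ioi h3, integral_mul_const,
        (integral_rpow_mul_one_sub_exp hs0 hs1 hξ).2, mul_assoc, norm_mul,
        Real.norm_of_nonneg (by positivity : 0 ≤ (‖ξ‖ ^ 2) ^ s)]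
      ring
  have hpt : EqOn (fun t : ℝ => t ^ (-1 - s) *
      (heatSemigroup n t (fun y => ∫ ξ, m ξ * Real.cos (inner ℝ y ξ)) x -
        ∫ ξ, m ξ * Real.cos (inner ℝ x ξ)))
      (fun t => -∫ ξ, t ^ (-1 - s) * (1 - Real.exp (-(t * ‖ξ‖ ^ 2))) *
        (m ξ * Real.cos (inner ℝ x ξ))) (Ioi 0) := by
    intro t ht
    have ht0 : 0 < t := ht
    simp only
    rw [heatSemigroup_cosineTransform hm ht0, ← integral_sub _ hmcos, ← integral_const_mul,
      ← integral_neg]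
    · congr 1 with ξ
      ring
    · refine hmcos.bdd_mul (c := 1) (by fun_prop) (.of_forall fun ξ => ?_)
      rw [Real.norm_of_nonneg (Real.exp_pos _).le, Real.exp_le_one_iff]
      have := mul_nonneg ht0.le (sq_nonneg ‖ξ‖)
      linarith
  unfold fracLap
  rw [setIntegral_congr_fun measurableSet_Ioi hpt, integral_neg, integral_integral_swap h_int,
    neg_mul_neg, ← integral_const_mul]
  refine integral_congr_ae ?_
  filter_upwards [hne] with ξ hξ
  rw [integral_mul_const, (integral_rpow_mul_one_sub_exp hs0 hs1 hξ).2]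
  field_simp

/-- The Gaussian mixture `∫ σ ^ (α - 1) e ^ (-1 / (4 σ) - σ lam) dσ`, a rescaled modified Bessel
function of the second kind. -/
noncomputable def besselMixture (α lam : ℝ) : ℝ :=
  ∫ σ in Ioi (0:ℝ), σ ^ (α - 1) * Real.exp (-(1 / (4 * σ))) * Real.exp (-σ * lam)

/-- The symmetry of the Bessel function in its order. -/
theorem rpow_mul_besselMixture {α lam : ℝ} (hl : 0 < lam) :
    lam ^ α * besselMixture α lam = 4 ^ (-α) * besselMixture (-α) lam := by
  unfold besselMixture
  set g : ℝ → ℝ := fun σ => σ ^ (α - 1) * Real.exp (-(1 / (4 * σ))) * Real.exp (-σ * lam) with hg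
  have h1 := integral_comp_rpow_Ioi g (by norm_num : (-1:ℝ) ≠ 0)
  have h2 := integral_comp_mul_left_Ioi
    (fun x : ℝ => (|(-1:ℝ)| * x ^ ((-1:ℝ) - 1)) • g (x ^ (-1:ℝ))) 0
    (by positivity : 0 < 4 * lam)
  rw [mul_zero, h1] at h2
  have h3 : EqOn (fun x : ℝ =>
      (|(-1:ℝ)| * (4 * lam * x) ^ ((-1:ℝ) - 1)) • g ((4 * lam * x) ^ (-1:ℝ)))
      (fun x => (4 * lam) ^ (-α - 1) *
        (x ^ (-α - 1) * Real.exp (-(1 / (4 * x))) * Real.exp (-x * lam))) (Ioi 0) := by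
    intro x hx
    have hx : 0 < x := hx
    have hlx : 0 < 4 * lam * x := by positivity
    simp only [hg, abs_neg, abs_one, one_mul, smul_eq_mul]
    rw [← Real.rpow_mul hlx.le, Real.rpow_neg_one,
      show (4 * lam * x) ^ ((-1:ℝ) - 1) * ((4 * lam * x) ^ (-1 * (α - 1)) *
        Real.exp (-(1 / (4 * (4 * lam * x)⁻¹))) * Real.exp (-(4 * lam * x)⁻¹ * lam)) =
        ((4 * lam * x) ^ ((-1:ℝ) - 1) * (4 * lam * x) ^ (-1 * (α - 1))) *
        Real.exp (-(1 / (4 * (4 * lam * x)⁻¹))) * Real.exp (-(4 * lam * x)⁻¹ * lam) by ring,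
      ← Real.rpow_add hlx, show (-1:ℝ) - 1 + -1 * (α - 1) = -α - 1 by ring,
      Real.mul_rpow (by positivity) hx.le,
      show -(1 / (4 * (4 * lam * x)⁻¹)) = -x * lam by field_simp,
      show -(4 * lam * x)⁻¹ * lam = -(1 / (4 * x)) by field_simp]
    ring
  rw [setIntegral_congr_fun measurableSet_Ioi h3, integral_const_mul, smul_eq_mul,
    Real.rpow_sub_one (by positivity), Real.mul_rpow (by norm_num) hl.le, Real.rpow_neg hl.le] at h2
  have hla := Real.rpow_pos_of_pos hl α
  change lam ^ α * (∫ y in Ioi (0:ℝ), g y) = _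
  generalize (∫ σ in Ioi (0:ℝ), σ ^ (-α - 1) * Real.exp (-(1 / (4 * σ))) *
    Real.exp (-σ * lam)) = J at h2 ⊢
  field_simp at h2
  linarith

theorem rpow_mul_pi_div_rpow {σ : ℝ} (hσ : 0 < σ) (α d : ℝ) :
    σ ^ (α - 1) * (π / σ) ^ d = π ^ d * σ ^ (-(d - α) - 1) := by
  rw [Real.div_rpow pi_pos.le hσ.le, show -(d - α) - 1 = (α - 1) - d by ring,
    Real.rpow_sub hσ (α - 1)]
  ring

/-- Joint integrability of the Gaussians underlying `besselMixture`. -/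
theorem integrable_rpow_mul_exp_mul_gaussian {n : ℕ} {α : ℝ} (hα : α < (n:ℝ) / 2) :
    Integrable (fun p : EuclideanSpace ℝ (Fin n) × ℝ =>
      p.2 ^ (α - 1) * Real.exp (-(1 / (4 * p.2))) * Real.exp (-p.2 * ‖p.1‖ ^ 2))
      (volume.prod (volume.restrict (Ioi 0))) := by
  have hβ : 0 < (n:ℝ) / 2 - α := by linarith
  refine (integrable_prod_iff' (Measurable.aestronglyMeasurable (by fun_prop))).2 ⟨?_, ?_⟩
  · filter_upwards [ae_restrict_mem measurableSet_Ioi] with σ hσ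
    exact (integrable_exp_neg_mul_sq_norm hσ).const_mul _
  · refine Integrable.congr (((integral_rpow_neg_mul_exp_neg_div
      (by norm_num : (0:ℝ) < 1 / 4) hβ).1).const_mul (π ^ ((n:ℝ) / 2))) ?_
    filter_upwards [ae_restrict_mem measurableSet_Ioi] with σ hσ
    have hσ : 0 < σ := hσ
    have h1 (ξ : EuclideanSpace ℝ (Fin n)) :
        ‖σ ^ (α - 1) * Real.exp (-(1 / (4 * σ))) * Real.exp (-σ * ‖ξ‖ ^ 2)‖ =
        σ ^ (α - 1) * Real.exp (-(1 / (4 * σ))) * Real.exp (-σ * ‖ξ‖ ^ 2) :=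
      Real.norm_of_nonneg (by positivity)
    simp_rw [h1]
    rw [integral_const_mul, GaussianFourier.integral_rexp_neg_mul_sq_norm hσ,
      finrank_euclideanSpace_fin, mul_right_comm, rpow_mul_pi_div_rpow hσ, div_div, mul_assoc]

/-- The cosine transform of a Gaussian mixture is an inverse power of `1 + ‖x‖ ^ 2`. -/
theorem cosineTransform_besselMixture {n : ℕ} {α : ℝ} (hα : α < (n:ℝ) / 2) :
    Integrable (fun ξ : EuclideanSpace ℝ (Fin n) => besselMixture α (‖ξ‖ ^ 2)) ∧
    ∀ x : EuclideanSpace ℝ (Fin n),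
      ∫ ξ, besselMixture α (‖ξ‖ ^ 2) * Real.cos (inner ℝ x ξ) =
        π ^ ((n:ℝ) / 2) * 4 ^ ((n:ℝ) / 2 - α) * Real.Gamma ((n:ℝ) / 2 - α) *
          (1 + ‖x‖ ^ 2) ^ (-((n:ℝ) / 2 - α)) := by
  have hβ : 0 < (n:ℝ) / 2 - α := by linarith
  have h_int := integrable_rpow_mul_exp_mul_gaussian (n := n) hα
  refine ⟨h_int.integral_prod_left, fun x => ?_⟩
  have hcos : AEStronglyMeasurable (fun p : EuclideanSpace ℝ (Fin n) × ℝ =>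
      Real.cos (inner ℝ x p.1)) (volume.prod (volume.restrict (Ioi 0))) := by fun_prop
  have h_int_cos := h_int.mul_bdd hcos (.of_forall fun p => Real.abs_cos_le_one _)
  unfold besselMixture
  simp_rw [← integral_mul_const]
  have hA : 0 < (1 + ‖x‖ ^ 2) / 4 := by positivity
  rw [integral_integral_swap (by exact h_int_cos)]
  have h2 : EqOn (fun σ : ℝ => ∫ ξ : EuclideanSpace ℝ (Fin n),
      σ ^ (α - 1) * Real.exp (-(1 / (4 * σ))) * Real.exp (-σ * ‖ξ‖ ^ 2) * Real.cos (inner ℝ x ξ))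
      (fun σ => π ^ ((n:ℝ) / 2) *
        (σ ^ (-((n:ℝ) / 2 - α) - 1) * Real.exp (-(((1 + ‖x‖ ^ 2) / 4) / σ)))) (Ioi 0) := by
    intro σ hσ
    have hσ : 0 < σ := hσ
    have h3 := integral_exp_neg_mul_sq_norm_mul_cos hσ 0 x
    simp only [zero_add, Real.cos_zero, mul_one] at h3
    simp only [mul_assoc] at h3 ⊢
    rw [integral_const_mul, integral_const_mul, h3, mul_left_comm (Real.exp _), ← mul_assoc,
      rpow_mul_pi_div_rpow hσ, ← Real.exp_add, mul_assoc]
    congr 3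
    field_simp
    ring
  rw [setIntegral_congr_fun measurableSet_Ioi h2, integral_const_mul,
    (integral_rpow_neg_mul_exp_neg_div hA hβ).2, one_div_div, Real.div_rpow (by norm_num)
      (by positivity), Real.rpow_neg (by positivity)]
  ring

/-- The intertwining formula for the fractional Laplacian. -/
theorem fracLap_rpow_one_add_sq_norm {n : ℕ} {s : ℝ} (hs0 : 0 < s) (hs1 : s < 1)
    (hsn : s < (n:ℝ) / 2) (c : ℝ) (x : EuclideanSpace ℝ (Fin n)) :
    fracLap n s (fun y => c * (1 + ‖y‖ ^ 2) ^ (-((n:ℝ) / 2 - s))) x =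
      c * (Real.Gamma ((n:ℝ) / 2 + s) / Real.Gamma ((n:ℝ) / 2 - s) * 2 ^ (2 * s)) *
        (1 + ‖x‖ ^ 2) ^ (-((n:ℝ) / 2 + s)) := by
  have hn : n ≠ 0 := by
    rintro rfl
    norm_num at hsn
    linarith
  have : Nonempty (Fin n) := ⟨⟨0, Nat.pos_of_ne_zero hn⟩⟩
  obtain ⟨hi1, hf1⟩ := cosineTransform_besselMixture hsn
  obtain ⟨hi2, hf2⟩ := cosineTransform_besselMixture (n := n) (α := -s) (by linarith)
  have hG := Real.Gamma_pos_of_pos (s := (n:ℝ) / 2 - s) (by linarith)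
  set C : ℝ := π ^ ((n:ℝ) / 2) * 4 ^ ((n:ℝ) / 2 - s) * Real.Gamma ((n:ℝ) / 2 - s) with hC
  have hCpos : 0 < C := by positivity
  have hu : (fun y : EuclideanSpace ℝ (Fin n) => c * (1 + ‖y‖ ^ 2) ^ (-((n:ℝ) / 2 - s))) =
      fun y => ∫ ξ, (c / C * besselMixture s (‖ξ‖ ^ 2)) * Real.cos (inner ℝ y ξ) := by
    ext y
    simp_rw [mul_assoc]
    rw [integral_const_mul, hf1 y]
    field_simp
  have hsym : (fun ξ : EuclideanSpace ℝ (Fin n) =>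
      (‖ξ‖ ^ 2) ^ s * (c / C * besselMixture s (‖ξ‖ ^ 2))) =ᵐ[volume]
      fun ξ => c / C * 4 ^ (-s) * besselMixture (-s) (‖ξ‖ ^ 2) := by
    filter_upwards [compl_mem_ae_iff.2 (measure_singleton (0 : EuclideanSpace ℝ (Fin n)))] with ξ hξ
    have hξ0 : ξ ≠ 0 := hξ
    rw [mul_left_comm, rpow_mul_besselMixture (by positivity), mul_assoc]
  rw [hu, fracLap_cosineTransform hn hs0 hs1 (hi1.const_mul _)
    ((hi2.const_mul _).congr hsym.symm)]
  have hcos : (fun ξ : EuclideanSpace ℝ (Fin n) =>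
      (‖ξ‖ ^ 2) ^ s * (c / C * besselMixture s (‖ξ‖ ^ 2)) * Real.cos (inner ℝ x ξ)) =ᵐ[volume]
      fun ξ => c / C * 4 ^ (-s) * (besselMixture (-s) (‖ξ‖ ^ 2) * Real.cos (inner ℝ x ξ)) := by
    filter_upwards [hsym] with ξ hξ
    rw [hξ, mul_assoc]
  rw [integral_congr_ae hcos]
  rw [integral_const_mul, hf2 x, hC, sub_neg_eq_add, Real.rpow_add (by norm_num : (0:ℝ) < 4),
    Real.rpow_sub (by norm_num : (0:ℝ) < 4), Real.rpow_neg (by norm_num : (0:ℝ) ≤ 4),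
    Real.rpow_mul (by norm_num : (0:ℝ) ≤ 2), show (2:ℝ) ^ (2:ℝ) = 4 by norm_num]
  have h4 := Real.rpow_pos_of_pos (by norm_num : (0:ℝ) < 4) s
  field_simp

theorem stmt_17 (n : ℕ) (hn : 2 ≤ n) (s : ℝ) (hs0 : 0 < s) (hs1 : s < 1)
    (c : ℝ)
    (hc : c = (Real.Gamma ((n:ℝ)/2 + s) / Real.Gamma ((n:ℝ)/2 - s) * 2 ^ (2*s))
        ^ (((n:ℝ) - 2*s)/(4*s)))
    (u : EuclideanSpace ℝ (Fin n) → ℝ)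
    (hu : u = fun x => c * (1 + ‖x‖^2) ^ (-(((n:ℝ) - 2*s)/2))) :
    (∀ x, 0 < u x) ∧
      ∀ x, fracLap n s u x = (u x) ^ (((n:ℝ) + 2*s)/((n:ℝ) - 2*s)) := by
  have hn' : (2:ℝ) ≤ n := by exact_mod_cast hn
  have hns : 0 < (n:ℝ) - 2 * s := by linarith
  have hG1 := Real.Gamma_pos_of_pos (s := (n:ℝ)/2 + s) (by linarith)
  have hG2 := Real.Gamma_pos_of_pos (s := (n:ℝ)/2 - s) (by linarith)
  have hexp : ((n:ℝ) - 2*s)/2 = (n:ℝ)/2 - s := by ring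
  set K : ℝ := Real.Gamma ((n:ℝ)/2 + s) / Real.Gamma ((n:ℝ)/2 - s) * 2 ^ (2*s) with hK
  have hKpos : 0 < K := by positivity
  have hcpos : 0 < c := by rw [hc]; positivity
  subst hu
  refine ⟨fun x => by positivity, fun x => ?_⟩
  have hx : 0 < 1 + ‖x‖ ^ 2 := by positivity
  simp only [hexp]
  rw [fracLap_rpow_one_add_sq_norm hs0 hs1 (by linarith), ← hK,
    Real.mul_rpow hcpos.le (by positivity), ← Real.rpow_mul hx.le]
  congr 1
  · rw [hc, ← Real.rpow_add_one hKpos.ne', ← Real.rpow_mul hKpos.le]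
    congr 1
    field_simp
    ring
  · congr 1
    rw [← hexp]
    field_simp
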